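/- Let G be a minimal counterexample, let v be a vertex of degree at least 9, and let u and u′ be two neighbors of v, both of degree 5, that lie at distance two in the cyclic order around v (i.e., exactly one neighbor of v lies between them in the cyclic order). Then u has a neighbor other than v of degree at least 8, or u has at least two neighbors other than v of degree at least 7. -/

import Mathlib

open SimpleGraph

variable {V : Type}

/-- The involution of the darts of a graph reversing each dart. -/
def dartRev (G : SimpleGraph V) : Equiv.Perm G.Dart :=
  Function.Involutive.toPerm SimpleGraph.Dart.symm SimpleGraph.Dart.symm_involutive

/-- The face permutation of a rotation system `σ`: it sends a dart `(u,v)` to `σ (v,u)`. -/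
def facePerm {G : SimpleGraph V} (σ : Equiv.Perm G.Dart) : Equiv.Perm G.Dart :=
  (dartRev G).trans σ

/-- The setoid on `α` whose classes are the orbits (cycles) of a permutation of `α`. -/
def orbitSetoid {α : Type*} (f : Equiv.Perm α) : Setoid α :=
  ⟨f.SameCycle, ⟨fun x => Equiv.Perm.SameCycle.refl f x, fun h => h.symm, fun h h' => h.trans h'⟩⟩

/-- The number of faces of a rotation system: the number of orbits of the face permutation. -/
noncomputable def numFaces {G : SimpleGraph V} (σ : Equiv.Perm G.Dart) : ℕ :=
  Nat.card (Quotient (orbitSetoid (facePerm σ)))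

/-- The number of darts in the face (orbit of the face permutation) containing the dart `d`. -/
noncomputable def faceSize {G : SimpleGraph V} (σ : Equiv.Perm G.Dart) (d : G.Dart) : ℕ :=
  Nat.card {e : G.Dart // (facePerm σ).SameCycle d e}

/-- `σ` is a rotation system on `G`: every dart and its image share their first vertex, and
the `σ`-orbit of every dart consists of all darts sharing its first vertex. -/
structure IsRotationSystem (G : SimpleGraph V) (σ : Equiv.Perm G.Dart) : Prop where
  fst_eq : ∀ d : G.Dart, (σ d).toProd.1 = d.toProd.1
  orbit_eq : ∀ d e : G.Dart, d.toProd.1 = e.toProd.1 → σ.SameCycle d e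

/-- The degree of a vertex. -/
noncomputable def deg (G : SimpleGraph V) (v : V) : ℕ := Nat.card (G.neighborSet v)

/-- A plane triangulation: a finite connected simple graph on at least 4 vertices equipped with
a rotation system satisfying Euler's formula `|V| - |E| + F = 2` in which every face consists of
exactly 3 darts. -/
structure IsPlaneTriangulation [Fintype V] (G : SimpleGraph V) (σ : Equiv.Perm G.Dart) :
    Prop where
  connected : G.Connected
  four_le_card : 4 ≤ Fintype.card V
  rot : IsRotationSystem G σ
  euler : Fintype.card V + numFaces σ = Nat.card G.edgeSet + 2
  face_size_eq : ∀ d : G.Dart, faceSize σ d = 3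

/-- A proper 5-coloring (colors `0,...,4` standing for `1,...,5`). -/
def Proper5 (G : SimpleGraph V) (c : V → Fin 5) : Prop :=
  ∀ ⦃u w : V⦄, G.Adj u w → c u ≠ c w

/-- A finite simple graph is planar if it is isomorphic to a subgraph of a plane triangulation. -/
def IsPlanar [Fintype V] (G : SimpleGraph V) : Prop :=
  ∃ (W : Type) (iW : Fintype W) (T : SimpleGraph W) (σ : Equiv.Perm T.Dart),
    @IsPlaneTriangulation W iW T σ ∧ ∃ f : G →g T, Function.Injective f

/-- `w` is the neighbor of `v` following `u` in the cyclic (counterclockwise) order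
around `v` given by the rotation system `σ`. -/
def NextNbr {G : SimpleGraph V} (σ : Equiv.Perm G.Dart) (v u w : V) : Prop :=
  ∃ h : G.Adj v u, (σ ⟨(v, u), h⟩).toProd.2 = w

/-- A minimal counterexample: a plane triangulation admitting no proper 5-coloring with some
color class of size at most `|V|/6`, while every planar graph on fewer vertices admits one. -/
def IsMinimalCounterexample [Fintype V] (G : SimpleGraph V) (σ : Equiv.Perm G.Dart) : Prop :=
  IsPlaneTriangulation G σ ∧
  (¬ ∃ c : V → Fin 5, Proper5 G c ∧
      ∃ k : Fin 5, 6 * Nat.card {v : V | c v = k} ≤ Fintype.card V) ∧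
  (∀ (W : Type) [Fintype W] (H : SimpleGraph W), IsPlanar H →
      Fintype.card W < Fintype.card V →
      ∃ c : W → Fin 5, Proper5 H c ∧
        ∃ k : Fin 5, 6 * Nat.card {w : W | c w = k} ≤ Fintype.card W)


section Homology

open Classical in
/-- boundary of a 2-chain -/
noncomputable def bdryTwo [Fintype V] {G : SimpleGraph V} (σ : Equiv.Perm G.Dart) :
    (Quotient (orbitSetoid (facePerm σ)) → ZMod 2) →ₗ[ZMod 2] (G.edgeSet → ZMod 2) where
  toFun φ := fun e => ∑ d : G.Dart with d.edge = e.1, φ (Quotient.mk _ d)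
  map_add' φ ψ := by ext e; simp [Finset.sum_add_distrib]
  map_smul' a φ := by ext e; simp [Finset.mul_sum]

open Classical in
/-- boundary of a 1-chain -/
noncomputable def bdryOne [Fintype V] (G : SimpleGraph V) :
    (G.edgeSet → ZMod 2) →ₗ[ZMod 2] (V → ZMod 2) where
  toFun z := fun v => ∑ d : G.Dart with d.fst = v, z ⟨d.edge, d.edge_mem⟩
  map_add' φ ψ := by ext e; simp [Finset.sum_add_distrib]
  map_smul' a φ := by ext e; simp [Finset.mul_sum]

theorem bdryTwo_apply [Fintype V] {G : SimpleGraph V} (σ : Equiv.Perm G.Dart)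
    (φ : Quotient (orbitSetoid (facePerm σ)) → ZMod 2) (d : G.Dart) :
    bdryTwo σ φ ⟨d.edge, d.edge_mem⟩ = φ (Quotient.mk _ d) + φ (Quotient.mk _ d.symm) := by
  classical
  change (∑ d' : G.Dart with d'.edge = d.edge, φ (Quotient.mk _ d')) = _
  have h2 : (Finset.univ.filter fun d' : G.Dart => d'.edge = d.edge) = {d, d.symm} := by
    ext d'
    simp [SimpleGraph.dart_edge_eq_iff]
  rw [h2, Finset.sum_pair d.symm_ne.symm]

theorem face_sigma {G : SimpleGraph V} (σ : Equiv.Perm G.Dart) (d : G.Dart) :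
    (Quotient.mk (orbitSetoid (facePerm σ)) (σ d)) = Quotient.mk _ d.symm := by
  apply Quotient.sound
  change (facePerm σ).SameCycle (σ d) d.symm
  refine Equiv.Perm.SameCycle.symm ⟨1, ?_⟩
  simp [facePerm, dartRev]

theorem zmod2_eq {a b : ZMod 2} (h : a + b = 0) : a = b := by
  revert a b; decide

theorem bdry_comp [Fintype V] {G : SimpleGraph V} {σ : Equiv.Perm G.Dart}
    (hr : IsRotationSystem G σ) : LinearMap.range (bdryTwo σ) ≤ LinearMap.ker (bdryOne G) := by
  classical
  rintro _ ⟨φ, rfl⟩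
  rw [LinearMap.mem_ker]
  ext v
  change (∑ d : G.Dart with d.fst = v, bdryTwo σ φ ⟨d.edge, d.edge_mem⟩) = 0
  simp_rw [bdryTwo_apply, ← face_sigma, Finset.sum_add_distrib]
  have : (∑ d : G.Dart with d.fst = v, φ (Quotient.mk _ (σ d)))
      = ∑ d : G.Dart with d.fst = v, φ (Quotient.mk (orbitSetoid (facePerm σ)) d) := by
    refine Finset.sum_equiv σ ?_ ?_
    · intro d
      simp [hr.fst_eq d]
    · intro d _; rfl
  rw [this]
  exact CharTwo.add_self_eq_zero _

theorem ker_bdryTwo [Fintype V] {G : SimpleGraph V} {σ : Equiv.Perm G.Dart}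
    (hr : IsRotationSystem G σ) (hc : G.Connected) :
    Module.finrank (ZMod 2) (LinearMap.ker (bdryTwo σ)) ≤ 1 := by
  classical
  have hle : LinearMap.ker (bdryTwo σ) ≤ Submodule.span (ZMod 2) {fun _ => 1} := by
    intro φ hφ
    rw [LinearMap.mem_ker] at hφ
    have h1 : ∀ d : G.Dart, φ (Quotient.mk _ d) = φ (Quotient.mk _ d.symm) := by
      intro d
      apply zmod2_eq
      rw [← bdryTwo_apply, hφ]; rfl
    have h2 : ∀ d e : G.Dart, d.fst = e.fst → φ (Quotient.mk _ d) = φ (Quotient.mk _ e) := by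
      intro d e hde
      obtain ⟨i, -, hi⟩ := (hr.orbit_eq d e hde).exists_pow_eq'
      subst hi
      clear hde
      induction i with
      | zero => rfl
      | succ n ih => rw [ih, pow_succ', Equiv.Perm.mul_apply, face_sigma, ← h1]
    have h3 : ∃ a, ∀ d : G.Dart, φ (Quotient.mk _ d) = a := by
      by_cases hne : Nonempty G.Dart
      · obtain ⟨d0⟩ := hne
        refine ⟨φ (Quotient.mk _ d0), ?_⟩
        have key : ∀ q, G.Reachable d0.fst q → ∀ d : G.Dart, d.fst = q →
            φ (Quotient.mk _ d) = φ (Quotient.mk _ d0) := by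
          intro q hq
          rw [SimpleGraph.reachable_iff_reflTransGen] at hq
          induction hq with
          | refl => intro d hd; exact h2 _ _ hd
          | @tail p q _ hpq ih =>
            intro d hd
            have e1 := ih ⟨(p, q), hpq⟩ rfl
            rw [h1] at e1
            rw [← e1]
            exact h2 _ _ hd
        intro d
        exact key d.fst (hc.preconnected _ _) d rfl
      · exact ⟨0, fun d => absurd ⟨d⟩ hne⟩
    obtain ⟨a, ha⟩ := h3
    rw [Submodule.mem_span_singleton]
    refine ⟨a, ?_⟩
    ext q
    induction q using Quotient.inductionOn with
    | h d => simp [ha d]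
  calc _ ≤ _ := Submodule.finrank_mono hle
    _ ≤ 1 := (finrank_span_le_card _).trans (by simp)

theorem bdryOne_single [Fintype V] [DecidableEq V] {G : SimpleGraph V} (d : G.Dart) :
    bdryOne G (fun e => if e.1 = d.edge then 1 else 0)
      = Pi.single d.fst 1 + Pi.single d.snd 1 := by
  classical
  ext v
  have h0 : bdryOne G (fun e => if e.1 = d.edge then 1 else 0) v =
      ∑ d' : G.Dart with d'.fst = v, if d'.edge = d.edge then (1 : ZMod 2) else 0 := by
    unfold bdryOne
    simp only [LinearMap.coe_mk, AddHom.coe_mk]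
    congr!
  rw [h0]
  have hne : d.fst ≠ d.snd := d.fst_ne_snd
  have h2 : ∀ d' : G.Dart, (if d'.edge = d.edge then (1 : ZMod 2) else 0)
      = (if d' = d then 1 else 0) + (if d' = d.symm then 1 else 0) := by
    intro d'
    simp only [SimpleGraph.dart_edge_eq_iff]
    by_cases h : d' = d
    · subst h; simp [d'.symm_ne.symm]
    · simp [h]
  simp_rw [h2, Finset.sum_add_distrib]
  simp only [Finset.sum_ite_eq', Finset.mem_filter, Finset.mem_univ, true_and,
    Pi.add_apply, Pi.single_apply]
  simp [eq_comm]

theorem range_bdryOne [Fintype V] {G : SimpleGraph V} (hc : G.Connected) :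
    Fintype.card V ≤ Module.finrank (ZMod 2) (LinearMap.range (bdryOne G)) + 1 := by
  classical
  obtain ⟨v0⟩ := hc.nonempty
  have htop : LinearMap.range (bdryOne G) ⊔
      Submodule.span (ZMod 2) {(Pi.single v0 1 : V → ZMod 2)} = ⊤ := by
    rw [eq_top_iff, ← (Pi.basisFun (ZMod 2) V).span_eq, Submodule.span_le]
    rintro _ ⟨q, rfl⟩
    rw [Pi.basisFun_apply]
    have hq := hc.preconnected v0 q
    rw [SimpleGraph.reachable_iff_reflTransGen] at hq
    induction hq with
    | refl => exact Submodule.mem_sup_right (Submodule.mem_span_singleton_self _)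
    | @tail p q _ hpq ih =>
      have h1 := bdryOne_single (G := G) ⟨(p, q), hpq⟩
      have h2 : (Pi.single q 1 : V → ZMod 2) = (Pi.single p 1 + Pi.single q 1) - Pi.single p 1 := by
        simp
      rw [h2]
      refine Submodule.sub_mem _ (Submodule.mem_sup_left ?_) ih
      exact ⟨_, h1⟩
  have h3 := Submodule.finrank_add_le_finrank_add_finrank (LinearMap.range (bdryOne G))
    (Submodule.span (ZMod 2) {(Pi.single v0 1 : V → ZMod 2)})
  rw [htop, finrank_top, Module.finrank_fintype_fun_eq_card] at h3
  have h4 : Module.finrank (ZMod 2) (Submodule.span (ZMod 2) {(Pi.single v0 1 : V → ZMod 2)}) ≤ 1 :=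
    (finrank_span_le_card _).trans (by simp)
  omega

theorem exists_phi [Fintype V] {G : SimpleGraph V} {σ : Equiv.Perm G.Dart}
    (hT : IsPlaneTriangulation G σ) (z : G.edgeSet → ZMod 2) (hz : bdryOne G z = 0) :
    ∃ φ : G.Dart → ZMod 2, (∀ d, φ d + φ (σ d) = z ⟨d.edge, d.edge_mem⟩) ∧
      (∀ d, φ d + φ d.symm = z ⟨d.edge, d.edge_mem⟩) := by
  classical
  have hle := bdry_comp hT.rot
  have h1 := ker_bdryTwo hT.rot hT.connected
  have h2 := range_bdryOne hT.connected
  have h3 := LinearMap.finrank_range_add_finrank_ker (bdryTwo σ)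
  have h4 := LinearMap.finrank_range_add_finrank_ker (bdryOne G)
  rw [Module.finrank_fintype_fun_eq_card] at h3 h4
  have h5 := hT.euler
  rw [numFaces, Nat.card_eq_fintype_card, Nat.card_eq_fintype_card] at h5
  have heq := Submodule.eq_of_le_of_finrank_le hle (by omega)
  have hmem : z ∈ LinearMap.range (bdryTwo σ) := by
    rw [heq]; exact hz
  obtain ⟨φ, rfl⟩ := hmem
  refine ⟨fun d => φ (Quotient.mk _ d), fun d => ?_, fun d => ?_⟩
  · rw [bdryTwo_apply, ← face_sigma]
  · rw [bdryTwo_apply]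

end Homology

theorem chain_exists [Fintype V] [DecidableEq V] {G : SimpleGraph V} (A : Set V) {a c : V}
    (h : Relation.ReflTransGen (fun p q => G.Adj p q ∧ p ∈ A ∧ q ∈ A) a c) :
    ∃ z : G.edgeSet → ZMod 2, bdryOne G z = Pi.single a 1 + Pi.single c 1 ∧
      ∀ d : G.Dart, (d.fst ∉ A ∨ d.snd ∉ A) → z ⟨d.edge, d.edge_mem⟩ = 0 := by
  induction h with
  | refl =>
    refine ⟨0, ?_, fun _ _ => rfl⟩
    rw [map_zero]
    ext v
    exact (CharTwo.add_self_eq_zero _).symm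
  | @tail p q _ hpq ih =>
    obtain ⟨z, hz, hs⟩ := ih
    refine ⟨z + fun e => if e.1 = (⟨(p, q), hpq.1⟩ : G.Dart).edge then 1 else 0, ?_, ?_⟩
    · rw [map_add, hz, bdryOne_single]
      have : (Pi.single p 1 : V → ZMod 2) + Pi.single p 1 = 0 := by
        ext v; exact CharTwo.add_self_eq_zero _
      calc _ = Pi.single a 1 + (Pi.single p 1 + Pi.single p 1) + Pi.single q 1 := by
            simp only []; abel
        _ = _ := by rw [this, add_zero]
    · intro d hd
      rw [Pi.add_apply, hs d hd, zero_add, if_neg]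
      rw [SimpleGraph.dart_edge_eq_iff]
      rintro (rfl | rfl)
      · rcases hd with hd | hd
        · exact hd hpq.2.1
        · exact hd hpq.2.2
      · rcases hd with hd | hd
        · exact hd hpq.2.2
        · exact hd hpq.2.1

/-- Two chains joining crossing pairs of neighbours of `t` must meet. -/
theorem no_crossing [Fintype V] {G : SimpleGraph V} {σ : Equiv.Perm G.Dart}
    (hT : IsPlaneTriangulation G σ) (A B : Set V) (hAB : ∀ p, p ∈ A → p ∉ B) (d0 : G.Dart)
    (htA : d0.fst ∉ A) (htB : d0.fst ∉ B) (i j k : ℕ) (hij : 0 < i) (hjk : i < j) (hk : j < k)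
    (hinj : ∀ m n, m ≤ k → n ≤ k → (σ ^ m) d0 = (σ ^ n) d0 → m = n)
    (ha : d0.snd ∈ A) (hb : ((σ ^ i) d0).snd ∈ B)
    (hA : Relation.ReflTransGen (fun p q => G.Adj p q ∧ p ∈ A ∧ q ∈ A) d0.snd ((σ ^ j) d0).snd)
    (hB : Relation.ReflTransGen (fun p q => G.Adj p q ∧ p ∈ B ∧ q ∈ B)
      ((σ ^ i) d0).snd ((σ ^ k) d0).snd) : False := by
  classical
  have hfst : ∀ m, ((σ ^ m) d0).fst = d0.fst := by
    intro m
    induction m with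
    | zero => rfl
    | succ n ih => rw [pow_succ', Equiv.Perm.mul_apply]; exact (hT.rot.fst_eq _).trans ih
  obtain ⟨z1, hz1, hs1⟩ := chain_exists A hA
  set dj := (σ ^ j) d0 with hdj
  set z : G.edgeSet → ZMod 2 := z1 + ((fun e => if e.1 = d0.edge then 1 else 0) +
    (fun e => if e.1 = dj.edge then 1 else 0)) with hzdef
  have hz : bdryOne G z = 0 := by
    rw [hzdef, map_add, map_add, hz1, bdryOne_single, bdryOne_single, hfst j]
    ext v
    simp only [Pi.add_apply, Pi.zero_apply]
    generalize (Pi.single d0.snd 1 : V → ZMod 2) v = x1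
    generalize (Pi.single dj.snd 1 : V → ZMod 2) v = x2
    generalize (Pi.single d0.fst 1 : V → ZMod 2) v = x3
    revert x1 x2 x3; decide
  obtain ⟨φ, hφ1, hφ2⟩ := exists_phi hT z hz
  have hcA : dj.snd ∈ A := by
    rcases Relation.ReflTransGen.cases_tail hA with h | ⟨p, _, h⟩
    · rw [h]; exact ha
    · exact h.2.2
  -- z vanishes on edges at vertices off the cycle
  have hzB : ∀ d : G.Dart, d.fst ∈ B → z ⟨d.edge, d.edge_mem⟩ = 0 := by
    intro d hd
    have e1 := hs1 d (Or.inl fun h => hAB _ h hd)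
    have aux : ∀ d' : G.Dart, d'.fst ∉ B → d'.snd ∉ B → d.edge ≠ d'.edge := by
      intro d' h1 h2 h3
      rw [SimpleGraph.dart_edge_eq_iff] at h3
      rcases h3 with rfl | rfl
      · exact h1 hd
      · exact h2 hd
    rw [hzdef]
    simp only [Pi.add_apply]
    rw [e1, if_neg (aux d0 htB (hAB _ ha)), if_neg (aux dj (by rw [hfst j]; exact htB) (hAB _ hcA))]
    rfl
  have hconst : ∀ d e : G.Dart, d.fst = e.fst → d.fst ∈ B → φ d = φ e := by
    intro d e hde hd
    obtain ⟨n, -, hn⟩ := (hT.rot.orbit_eq d e hde).exists_pow_eq'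
    subst hn
    clear hde
    have key : φ d = φ ((σ ^ n) d) ∧ ((σ ^ n) d).fst ∈ B := by
      induction n with
      | zero => exact ⟨rfl, hd⟩
      | succ n ih =>
        rw [pow_succ', Equiv.Perm.mul_apply]
        refine ⟨ih.1.trans (zmod2_eq ?_), ?_⟩
        · rw [hφ1, hzB _ ih.2]
        · have := hT.rot.fst_eq ((σ ^ n) d)
          change (σ _).fst = _ at this
          rw [this]; exact ih.2
    exact key.1
  have hBconst : ∀ q, Relation.ReflTransGen (fun p q => G.Adj p q ∧ p ∈ B ∧ q ∈ B)
      ((σ ^ i) d0).snd q → q ∈ B ∧ ∀ d : G.Dart, d.fst = q → φ d = φ ((σ ^ i) d0).symm := by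
    intro q hq
    induction hq with
    | refl => exact ⟨hb, fun d hd => hconst _ _ hd (by rw [hd]; exact hb)⟩
    | @tail p q _ hpq ih =>
      refine ⟨hpq.2.2, fun d hd => ?_⟩
      have e1 := ih.2 ⟨(p, q), hpq.1⟩ rfl
      have e2 := hφ2 ⟨(p, q), hpq.1⟩
      rw [hzB _ hpq.2.1] at e2
      rw [← e1, zmod2_eq e2]
      exact hconst _ _ hd (by rw [hd]; exact hpq.2.2)
  have e1 := (hBconst _ hB).2 ((σ ^ k) d0).symm rfl
  have hsymm : ∀ d : G.Dart, d.snd ∈ B → φ d = φ d.symm := by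
    intro d hd
    apply zmod2_eq
    rw [hφ2]
    have := hzB d.symm hd
    simpa using this
  rw [← hsymm _ (hBconst _ hB).1, ← hsymm _ hb] at e1
  -- going around t
  have hzt : ∀ m, m ≤ k → z ⟨((σ ^ m) d0).edge, ((σ ^ m) d0).edge_mem⟩ =
      (if m = 0 then 1 else 0) + (if m = j then 1 else 0) := by
    intro m hm
    rw [hzdef]
    simp only [Pi.add_apply]
    rw [hs1 _ (Or.inl (by rw [hfst]; exact htA)), zero_add]
    have aux : ∀ n, n ≤ k → (((σ ^ m) d0).edge = ((σ ^ n) d0).edge ↔ m = n) := by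
      intro n hn
      rw [SimpleGraph.dart_edge_eq_iff]
      constructor
      · rintro (h | h)
        · exact hinj _ _ hm hn h
        · exfalso
          have h1 : ((σ ^ m) d0).fst = ((σ ^ n) d0).symm.fst := by rw [h]
          rw [hfst] at h1
          have h2 : ((σ ^ n) d0).snd = d0.fst := h1.symm
          exact ((σ ^ n) d0).fst_ne_snd ((hfst n).trans h2.symm)
      · rintro rfl; exact Or.inl rfl
    have a0 := aux 0 (Nat.zero_le _)
    have aj := aux j hk.le
    rw [pow_zero, Equiv.Perm.one_apply] at a0
    congr 1
    · simp only [a0]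
    · simp only [hdj, aj]
  have hstep : ∀ m, m < k → φ ((σ ^ m) d0) + φ ((σ ^ (m + 1)) d0) =
      (if m = 0 then 1 else 0) + (if m = j then 1 else 0) := by
    intro m hm
    rw [pow_succ', Equiv.Perm.mul_apply, hφ1, hzt m hm.le]
  have hw1 : ∀ m, i ≤ m → m ≤ j → φ ((σ ^ m) d0) = φ ((σ ^ i) d0) := by
    intro m hm
    induction m, hm using Nat.le_induction with
    | base => intro _; rfl
    | succ m hm ih =>
      intro hmj
      have := hstep m (by omega)
      rw [if_neg (by omega), if_neg (by omega), add_zero] at this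
      rw [← zmod2_eq this]; exact ih (by omega)
  have hw2 : ∀ m, j + 1 ≤ m → m ≤ k → φ ((σ ^ m) d0) = φ ((σ ^ (j + 1)) d0) := by
    intro m hm
    induction m, hm using Nat.le_induction with
    | base => intro _; rfl
    | succ m hm ih =>
      intro hmj
      have := hstep m (by omega)
      rw [if_neg (by omega), if_neg (by omega), add_zero] at this
      rw [← zmod2_eq this]; exact ih (by omega)
  have e3 := hstep j hk
  rw [if_neg (by omega), if_pos rfl, hw1 j (by omega) le_rfl, ← hw2 k (by omega) le_rfl, e1,
    CharTwo.add_self_eq_zero] at e3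
  exact absurd e3 (by decide)

/-- `S` can be properly coloured such that the class of `k` inside `S` is exactly `K`. -/
def GoodCol (G : SimpleGraph V) (k : Fin 5) (S K : Set V) : Prop :=
  ∃ c : V → Fin 5, (∀ p q, p ∈ S → q ∈ S → G.Adj p q → c p ≠ c q) ∧ ∀ q ∈ S, (c q = k ↔ q ∈ K)

theorem good_of_color {G : SimpleGraph V} {k : Fin 5} {S K' : Set V} {t : V} (ht : t ∉ S)
    (c : V → Fin 5) (hc : ∀ p q, p ∈ S → q ∈ S → G.Adj p q → c p ≠ c q)
    (α : Fin 5) (hα : ∀ q ∈ S, G.Adj t q → c q ≠ α)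
    (hk : ∀ q ∈ S, (c q = k ↔ q ∈ K')) (htk : α = k ↔ t ∈ K') :
    GoodCol G k (insert t S) K' := by
  classical
  have hne : ∀ q ∈ S, q ≠ t := fun q hq h => ht (h ▸ hq)
  refine ⟨Function.update c t α, ?_, ?_⟩
  · rintro p q (rfl | hp) (rfl | hq) hpq
    · exact absurd hpq (G.loopless.irrefl _)
    · rw [Function.update_self, Function.update_of_ne (hne q hq)]
      exact (hα q hq hpq).symm
    · rw [Function.update_self, Function.update_of_ne (hne p hp)]
      exact hα p hp hpq.symm
    · rw [Function.update_of_ne (hne q hq), Function.update_of_ne (hne p hp)]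
      exact hc p q hp hq hpq
  · rintro q (rfl | hq)
    · rw [Function.update_self]; exact htk
    · rw [Function.update_of_ne (hne q hq)]; exact hk q hq

theorem good_insert_five {G : SimpleGraph V} {k : Fin 5} {S K : Set V} (h : GoodCol G k S K)
    {t : V} (ht : t ∉ S) (hn : ∀ q ∈ K, q ∈ S → ¬ G.Adj t q) :
    GoodCol G k (insert t S) (insert t K) := by
  obtain ⟨c, hc, hk⟩ := h
  refine good_of_color ht c hc k ?_ ?_ (by simp)
  · intro q hq hadj hck
    exact hn q ((hk q hq).1 hck) hq hadj
  · intro q hq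
    rw [hk q hq, Set.mem_insert_iff, or_iff_right]
    rintro rfl; exact ht hq

theorem kempe_swap {G : SimpleGraph V} {k : Fin 5} {S K : Set V} {t : V} (ht : t ∉ S)
    (htK : t ∉ K)
    (c : V → Fin 5) (hc : ∀ p q, p ∈ S → q ∈ S → G.Adj p q → c p ≠ c q)
    (hk : ∀ q ∈ S, (c q = k ↔ q ∈ K)) (a g : Fin 5) (ha : a ≠ k) (hg : g ≠ k) (hag : a ≠ g)
    (na ng : V) (hnaS : na ∈ S) (hca : c na = a)
    (hua : ∀ q ∈ S, G.Adj t q → c q = a → q = na)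
    (hug : ∀ q ∈ S, G.Adj t q → c q = g → q = ng)
    (hnr : ¬ Relation.ReflTransGen (fun p q => G.Adj p q ∧ p ∈ {x | x ∈ S ∧ (c x = a ∨ c x = g)} ∧
      q ∈ {x | x ∈ S ∧ (c x = a ∨ c x = g)}) na ng) :
    GoodCol G k (insert t S) K := by
  classical
  set R := Relation.ReflTransGen (fun p q => G.Adj p q ∧
    p ∈ {x | x ∈ S ∧ (c x = a ∨ c x = g)} ∧ q ∈ {x | x ∈ S ∧ (c x = a ∨ c x = g)}) na with hR
  have hmem : ∀ q, R q → c q = a ∨ c q = g := by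
    intro q hq
    rcases Relation.ReflTransGen.cases_tail hq with h | ⟨p, _, h⟩
    · rw [h]; exact Or.inl hca
    · exact h.2.2.2
  have hsw : ∀ q, R q → (c q = a ∧ Equiv.swap a g (c q) = g) ∨
      (c q = g ∧ Equiv.swap a g (c q) = a) := by
    intro q hq
    rcases hmem q hq with h | h
    · left; simp [h]
    · right; simp [h]
  have hstep : ∀ p q, R p → p ∈ S → q ∈ S → G.Adj p q → ¬ R q → c q ≠ a ∧ c q ≠ g := by
    intro p q hp hpS hqS hpq hq
    by_contra hcon
    apply hq
    refine Relation.ReflTransGen.tail hp ⟨hpq, ⟨hpS, hmem p hp⟩, hqS, ?_⟩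
    by_contra h2
    push Not at h2
    exact hcon h2
  refine good_of_color ht (fun q => if R q then Equiv.swap a g (c q) else c q) ?_ a ?_ ?_ ?_
  · intro p q hp hq hpq
    by_cases h1 : R p <;> by_cases h2 : R q <;> simp only [h1, h2, if_true, if_false]
    · intro h; exact hc p q hp hq hpq ((Equiv.swap a g).injective h)
    · have := hstep p q h1 hp hq hpq h2
      rcases hsw p h1 with h | h <;> rw [h.2]
      · exact this.2.symm
      · exact this.1.symm
    · have := hstep q p h2 hq hp hpq.symm h1
      rcases hsw q h2 with h | h <;> rw [h.2]
      · exact this.2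
      · exact this.1
    · exact hc p q hp hq hpq
  · intro q hq htq
    by_cases h1 : R q <;> simp only [h1, if_true, if_false]
    · rcases hsw q h1 with h | h <;> rw [h.2]
      · exact hag.symm
      · exact absurd (hug q hq htq h.1 ▸ h1) hnr
    · intro h
      exact h1 (hua q hq htq h ▸ Relation.ReflTransGen.refl)
  · intro q hq
    rw [← hk q hq]
    by_cases h1 : R q <;> simp only [h1, if_true, if_false]
    rcases hsw q h1 with h | h <;> rw [h.2, h.1] <;> simp [ha, hg]
  · simp [ha, htK]

theorem fin5_four (k : Fin 5) : ∃ a b c d : Fin 5, a ≠ k ∧ b ≠ k ∧ c ≠ k ∧ d ≠ k ∧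
    a ≠ b ∧ a ≠ c ∧ a ≠ d ∧ b ≠ c ∧ b ≠ d ∧ c ≠ d := by
  revert k; decide

/-- A vertex seeing at most four vertices of colour other than `k` can be coloured. -/
theorem good_insert [Fintype V] {G : SimpleGraph V} {σ : Equiv.Perm G.Dart}
    (hT : IsPlaneTriangulation G σ) {k : Fin 5} {S K : Set V} (h : GoodCol G k S K)
    {t : V} (ht : t ∉ S) (htK : t ∉ K) (M : Finset V)
    (hM : ∀ m ∈ M, G.Adj t m ∧ (m ∉ S ∨ m ∈ K)) (hdeg : deg G t ≤ 4 + M.card) :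
    GoodCol G k (insert t S) K := by
  classical
  obtain ⟨c, hc, hk⟩ := h
  by_cases hfree : ∃ α, α ≠ k ∧ ∀ q ∈ S, G.Adj t q → c q ≠ α
  · obtain ⟨α, hα, hq⟩ := hfree
    exact good_of_color ht c hc α hq hk (by simp [hα, htK])
  push Not at hfree
  choose n hnS hnadj hnc using hfree
  -- the list of relevant neighbours
  set L : Finset V := Finset.univ.filter fun q => G.Adj t q ∧ q ∈ S ∧ q ∉ K with hL
  have hLcard : L.card ≤ 4 := by
    have h1 : Disjoint L M := by
      rw [Finset.disjoint_left]
      intro q hq hqM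
      simp only [hL, Finset.mem_filter, Finset.mem_univ, true_and] at hq
      rcases (hM q hqM).2 with h | h
      · exact h hq.2.1
      · exact hq.2.2 h
    have h2 : L ∪ M ⊆ G.neighborFinset t := by
      intro q hq
      rw [SimpleGraph.mem_neighborFinset]
      rcases Finset.mem_union.1 hq with h | h
      · simp only [hL, Finset.mem_filter, Finset.mem_univ, true_and] at h
        exact h.1
      · exact (hM q h).1
    have h3 := Finset.card_le_card h2
    rw [Finset.card_union_of_disjoint h1, SimpleGraph.card_neighborFinset_eq_degree] at h3
    rw [deg, Nat.card_eq_fintype_card, SimpleGraph.card_neighborSet_eq_degree] at hdeg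
    omega
  have himg : Finset.univ.erase k ⊆ L.image c := by
    intro α hα
    have hα' := Finset.ne_of_mem_erase hα
    rw [Finset.mem_image]
    refine ⟨n α hα', ?_, hnc α hα'⟩
    simp only [hL, Finset.mem_filter, Finset.mem_univ, true_and]
    refine ⟨hnadj _ _, hnS _ _, ?_⟩
    rw [← hk _ (hnS _ _), hnc]; exact hα'
  have hinj : Set.InjOn c L := by
    rw [← Finset.card_image_iff]
    have h1 := Finset.card_le_card himg
    have h2 : (Finset.univ.erase k).card = 4 := by
      rw [Finset.card_erase_of_mem (Finset.mem_univ _)]; simp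
    have h3 : (L.image c).card ≤ L.card := Finset.card_image_le
    omega
  have huniq : ∀ α (hα : α ≠ k) q, q ∈ S → G.Adj t q → c q = α → q = n α hα := by
    intro α hα q hq hadj hcq
    apply hinj
    · simp only [hL, Finset.coe_filter, Finset.mem_univ, true_and, Set.mem_ofPred_eq]
      refine ⟨hadj, hq, ?_⟩
      rw [← hk q hq, hcq]; exact hα
    · simp only [hL, Finset.coe_filter, Finset.mem_univ, true_and, Set.mem_ofPred_eq]
      refine ⟨hnadj _ _, hnS _ _, ?_⟩
      rw [← hk _ (hnS _ _), hnc]; exact hα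
    · rw [hcq, hnc]
  obtain ⟨a, b, g, d, ha, hb, hg, hd, hab, hag, had, hbg, hbd, hgd⟩ := fin5_four k
  set d0 : G.Dart := ⟨(t, n a ha), hnadj a ha⟩ with hd0
  have hex : ∀ α (hα : α ≠ k), ∃ m : ℕ, (σ ^ m) d0 = ⟨(t, n α hα), hnadj α hα⟩ := by
    intro α hα
    obtain ⟨i, -, hi⟩ := (hT.rot.orbit_eq d0 ⟨(t, n α hα), hnadj α hα⟩ rfl).exists_pow_eq'
    exact ⟨i, hi⟩
  have hposex : ∀ α (hα : α ≠ k), ∃ m : ℕ, (σ ^ m) d0 = ⟨(t, n α hα), hnadj α hα⟩ ∧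
      ∀ m' < m, (σ ^ m') d0 ≠ ⟨(t, n α hα), hnadj α hα⟩ := fun α hα =>
    ⟨Nat.find (hex α hα), Nat.find_spec (hex α hα), fun m' hm' => Nat.find_min (hex α hα) hm'⟩
  choose pos hpos hmin using hposex
  have hpne : ∀ α β (hα : α ≠ k) (hβ : β ≠ k), α ≠ β → pos α hα ≠ pos β hβ := by
    intro α β hα hβ hne he
    have h1 := hpos α hα
    rw [he, hpos β hβ] at h1
    have h2 : n β hβ = n α hα := congrArg (fun d : G.Dart => d.snd) h1
    apply hne
    rw [← hnc α hα, ← hnc β hβ, h2]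
  have hpospos : ∀ α (hα : α ≠ k), α ≠ a → 0 < pos α hα := by
    intro α hα hne
    rw [Nat.pos_iff_ne_zero]
    intro h0
    have h1 := hpos α hα
    rw [h0, pow_zero, Equiv.Perm.one_apply] at h1
    have h2 : n a ha = n α hα := congrArg (fun d : G.Dart => d.snd) h1
    apply hne
    rw [← hnc α hα, ← hnc a ha, h2]
  have claim : ∀ b g d (hb : b ≠ k) (hg : g ≠ k) (hd : d ≠ k), a ≠ b → a ≠ g → a ≠ d → b ≠ g →
      b ≠ d → g ≠ d → pos b hb < pos g hg → pos g hg < pos d hd →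
      GoodCol G k (insert t S) K := by
    intro b g d hb hg hd hab hag had hbg hbd hgd hlt1 hlt2
    by_contra hcon
    have hA : Relation.ReflTransGen (fun p q => G.Adj p q ∧
        p ∈ {x | x ∈ S ∧ (c x = a ∨ c x = g)} ∧ q ∈ {x | x ∈ S ∧ (c x = a ∨ c x = g)})
        (n a ha) (n g hg) := by
      by_contra hA
      exact hcon (kempe_swap ht htK c hc hk a g ha hg hag _ _ (hnS a ha) (hnc a ha)
        (huniq a ha) (huniq g hg) hA)
    have hB : Relation.ReflTransGen (fun p q => G.Adj p q ∧
        p ∈ {x | x ∈ S ∧ (c x = b ∨ c x = d)} ∧ q ∈ {x | x ∈ S ∧ (c x = b ∨ c x = d)})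
        (n b hb) (n d hd) := by
      by_contra hB
      exact hcon (kempe_swap ht htK c hc hk b d hb hd hbd _ _ (hnS b hb) (hnc b hb)
        (huniq b hb) (huniq d hd) hB)
    refine no_crossing hT {x | x ∈ S ∧ (c x = a ∨ c x = g)} {x | x ∈ S ∧ (c x = b ∨ c x = d)}
      ?_ d0 (fun h => ht h.1) (fun h => ht h.1) (pos b hb) (pos g hg) (pos d hd)
      (hpospos b hb hab.symm) hlt1 hlt2 ?_ ⟨hnS a ha, Or.inl (hnc a ha)⟩ ?_ ?_ ?_
    · rintro p ⟨_, h1⟩ ⟨_, h2⟩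
      rcases h1 with h1 | h1 <;> rcases h2 with h2 | h2 <;> rw [h1] at h2
      · exact hab h2
      · exact had h2
      · exact hbg h2.symm
      · exact hgd h2
    · have aux : ∀ m n, m < n → n ≤ pos d hd → (σ ^ m) d0 = (σ ^ n) d0 → False := by
        intro m n' hmn hn he
        apply hmin d hd (pos d hd - n' + m) (by omega)
        rw [pow_add, Equiv.Perm.mul_apply, he, ← Equiv.Perm.mul_apply, ← pow_add,
          Nat.sub_add_cancel hn, hpos]
      intro m n' hm hn he
      rcases lt_trichotomy m n' with h | h | h
      · exact (aux m n' h hn he).elim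
      · exact h
      · exact (aux n' m h hm he.symm).elim
    · rw [hpos]; exact ⟨hnS b hb, Or.inl (hnc b hb)⟩
    · rw [hpos]; exact hA
    · rw [hpos, hpos]; exact hB
  rcases lt_or_gt_of_ne (hpne b g hb hg hbg) with h1 | h1 <;>
  rcases lt_or_gt_of_ne (hpne b d hb hd hbd) with h2 | h2 <;>
  rcases lt_or_gt_of_ne (hpne g d hg hd hgd) with h3 | h3
  · exact claim b g d hb hg hd hab hag had hbg hbd hgd h1 h3
  · exact claim b d g hb hd hg hab had hag hbd hbg hgd.symm h2 h3
  · omega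
  · exact claim d b g hd hb hg had hab hag hbd.symm hgd.symm hbg h2 h1
  · exact claim g b d hg hb hd hag hab had hbg.symm hgd hbd h1 h2
  · omega
  · exact claim g d b hg hd hb hag had hab hgd hbg.symm hbd.symm h3 h2
  · exact claim d g b hd hg hb had hag hab hgd.symm hbd.symm hbg.symm h3 h1

theorem del_good [Fintype V] {G : SimpleGraph V} {σ : Equiv.Perm G.Dart}
    (hG : IsMinimalCounterexample G σ) (D : Finset V) (hD : D.Nonempty) :
    ∃ (k : Fin 5) (K : Set V), (∀ q ∈ K, q ∉ D) ∧ GoodCol G k {q | q ∉ D} K ∧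
      6 * K.ncard + D.card ≤ Fintype.card V := by
  classical
  have hcard : Fintype.card {q : V // q ∉ D} = Fintype.card V - D.card := by
    rw [Fintype.card_subtype_compl]; simp
  have hDle : D.card ≤ Fintype.card V := Finset.card_le_univ D
  have hDpos := hD.card_pos
  obtain ⟨c, hc, k, hk⟩ := hG.2.2 {q : V // q ∉ D} (G.comap Subtype.val)
    ⟨V, inferInstance, G, σ, hG.1, ⟨Subtype.val, fun h => h⟩, Subtype.val_injective⟩ (by omega)
  refine ⟨k, Subtype.val '' {q | c q = k}, ?_, ⟨fun q => if h : q ∉ D then c ⟨q, h⟩ else k, ?_, ?_⟩, ?_⟩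
  · rintro _ ⟨q, _, rfl⟩; exact q.2
  · intro p q hp hq hpq
    have hp' : p ∉ D := hp
    have hq' : q ∉ D := hq
    simp only [hp', hq', not_false_eq_true, dite_true]
    exact hc (u := ⟨p, hp'⟩) (w := ⟨q, hq'⟩) hpq
  · intro q hq
    have hq' : q ∉ D := hq
    simp only [hq', not_false_eq_true, dite_true]
    constructor
    · intro h; exact ⟨⟨q, hq'⟩, h, rfl⟩
    · rintro ⟨q', h, rfl⟩; exact h
  · rw [Set.ncard_image_of_injective _ Subtype.val_injective]
    have : Set.ncard {q | c q = k} = Nat.card {q | c q = k} := rfl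
    rw [this]
    omega

theorem not_good_univ [Fintype V] {G : SimpleGraph V} {σ : Equiv.Perm G.Dart}
    (hG : IsMinimalCounterexample G σ) (k : Fin 5) (K : Set V)
    (h : GoodCol G k {q | q ∉ ([] : List V)} K) (hK : 6 * K.ncard ≤ Fintype.card V) : False := by
  obtain ⟨c, hc, hk⟩ := h
  refine hG.2.1 ⟨c, fun p q hpq => hc p q (by simp) (by simp) hpq, k, ?_⟩
  have : {v | c v = k} = K := by
    ext q; exact hk q (by simp)
  rw [this]; exact hK

theorem step_five {G : SimpleGraph V} {k : Fin 5} {K : Set V} {t : V} {l : List V}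
    (h : GoodCol G k {q | q ∉ t :: l} K) (htl : t ∉ l) (hn : ∀ q ∈ K, ¬ G.Adj t q) :
    GoodCol G k {q | q ∉ l} (insert t K) := by
  have e : {q | q ∉ l} = insert t {q | q ∉ t :: l} := by
    ext q; simp only [Set.mem_ofPred_eq, Set.mem_insert_iff, List.mem_cons]
    by_cases h : q = t
    · subst h; simp [htl]
    · simp [h]
  rw [e]
  exact good_insert_five h (by simp) (fun q hq _ => hn q hq)

theorem step_M [Fintype V] {G : SimpleGraph V} {σ : Equiv.Perm G.Dart}
    (hT : IsPlaneTriangulation G σ) {k : Fin 5} {K : Set V} {t : V} {l : List V}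
    (h : GoodCol G k {q | q ∉ t :: l} K) (htl : t ∉ l) (htK : t ∉ K) (M : Finset V)
    (hM : ∀ m ∈ M, G.Adj t m ∧ (m ∈ l ∨ m ∈ K)) (hdeg : deg G t ≤ 4 + M.card) :
    GoodCol G k {q | q ∉ l} K := by
  have e : {q | q ∉ l} = insert t {q | q ∉ t :: l} := by
    ext q; simp only [Set.mem_ofPred_eq, Set.mem_insert_iff, List.mem_cons]
    by_cases h : q = t
    · subst h; simp [htl]
    · simp [h]
  rw [e]
  refine good_insert hT h (by simp) htK M (fun m hm => ⟨(hM m hm).1, ?_⟩) hdeg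
  rcases (hM m hm).2 with h1 | h1
  · left; simp [h1]
  · exact Or.inr h1

section Steps

variable [Fintype V] {G : SimpleGraph V} {σ : Equiv.Perm G.Dart}

theorem step1 (hT : IsPlaneTriangulation G σ) {k : Fin 5} {K : Set V} {t : V} {l : List V}
    (m : V) (h : GoodCol G k {q | q ∉ t :: l} K) (hdeg : deg G t ≤ 5) (hm : G.Adj t m)
    (hs : t ∉ l ∧ t ∉ K ∧ (m ∈ l ∨ m ∈ K)) :
    GoodCol G k {q | q ∉ l} K := by
  classical
  refine step_M hT h hs.1 hs.2.1 {m} ?_ (by simpa using hdeg)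
  simp [hm, hs.2.2]

theorem step2 (hT : IsPlaneTriangulation G σ) {k : Fin 5} {K : Set V} {t : V} {l : List V}
    (m n : V) (h : GoodCol G k {q | q ∉ t :: l} K) (hdeg : deg G t ≤ 6) (hm : G.Adj t m)
    (hn : G.Adj t n)
    (hs : t ∉ l ∧ t ∉ K ∧ m ≠ n ∧ (m ∈ l ∨ m ∈ K) ∧ (n ∈ l ∨ n ∈ K)) :
    GoodCol G k {q | q ∉ l} K := by
  classical
  refine step_M hT h hs.1 hs.2.1 {m, n} ?_ ?_
  · simp [hm, hn, hs.2.2.2]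
  · rw [Finset.card_pair hs.2.2.1]; exact hdeg

theorem step3 (hT : IsPlaneTriangulation G σ) {k : Fin 5} {K : Set V} {t : V} {l : List V}
    (m n p : V) (h : GoodCol G k {q | q ∉ t :: l} K) (hdeg : deg G t ≤ 7) (hm : G.Adj t m)
    (hn : G.Adj t n) (hp : G.Adj t p)
    (hs : t ∉ l ∧ t ∉ K ∧ (m ≠ n ∧ m ≠ p ∧ n ≠ p) ∧ (m ∈ l ∨ m ∈ K) ∧ (n ∈ l ∨ n ∈ K) ∧
      (p ∈ l ∨ p ∈ K)) :
    GoodCol G k {q | q ∉ l} K := by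
  classical
  refine step_M hT h hs.1 hs.2.1 {m, n, p} ?_ ?_
  · simp [hm, hn, hp, hs.2.2.2]
  · rw [Finset.card_eq_three.2 ⟨m, n, p, hs.2.2.1.1, hs.2.2.1.2.1, hs.2.2.1.2.2, rfl⟩]; exact hdeg

/-- Like `step2` for a vertex of degree at most 6, or 7 if it sees the class `K0`. -/
theorem stepE (hT : IsPlaneTriangulation G σ) {k : Fin 5} {K K0 : Set V} {t : V} {l : List V}
    (m n : V) (h : GoodCol G k {q | q ∉ t :: l} K) (hK : K0 ⊆ K)
    (hdeg : deg G t ≤ 6 ∨ (deg G t ≤ 7 ∧ ∃ p ∈ K0, G.Adj t p)) (hm : G.Adj t m)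
    (hn : G.Adj t n) (hm0 : m ∉ K0) (hn0 : n ∉ K0)
    (hs : t ∉ l ∧ t ∉ K ∧ m ≠ n ∧ (m ∈ l ∨ m ∈ K) ∧ (n ∈ l ∨ n ∈ K)) :
    GoodCol G k {q | q ∉ l} K := by
  rcases hdeg with h6 | ⟨h7, p, hp, hadj⟩
  · exact step2 hT m n h h6 hm hn hs
  · refine step3 hT m n p h h7 hm hn hadj ⟨hs.1, hs.2.1, ⟨hs.2.2.1, ?_, ?_⟩, hs.2.2.2.1, hs.2.2.2.2,
      Or.inr (hK hp)⟩
    · rintro rfl; exact hm0 hp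
    · rintro rfl; exact hn0 hp

theorem min_deg (hG : IsMinimalCounterexample G σ) (t : V) : 5 ≤ deg G t := by
  classical
  by_contra hlt
  obtain ⟨k, K, hKD, hg, hcard⟩ := del_good hG {t} (by simp)
  refine not_good_univ hG k K (step_M hG.1 (t := t) (l := []) ?_ (by simp) ?_ ∅ (by simp) ?_) ?_
  · simpa using hg
  · intro h; exact hKD t h (by simp)
  · simp; omega
  · omega

set_option maxHeartbeats 1000000 in
theorem core (hG : IsMinimalCounterexample G σ) (v u w x y z u' : V)
    (hnd : [v, u, w, x, y, z, u'].Nodup)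
    (uv : G.Adj u v) (uw : G.Adj u w) (ux : G.Adj u x) (uy : G.Adj u y) (uz : G.Adj u z)
    (vw : G.Adj v w) (wx : G.Adj w x) (xy : G.Adj x y) (yz : G.Adj y z) (zv : G.Adj z v)
    (vu' : G.Adj v u') (wu' : G.Adj w u') (du : deg G u ≤ 5) (du' : deg G u' ≤ 5)
    (hw : deg G w ≤ 7) (hx : deg G x ≤ 7) (hy : deg G y ≤ 7) (hz : deg G z ≤ 7)
    (h7 : (deg G x ≤ 6 ∧ deg G y ≤ 6 ∧ deg G z ≤ 6) ∨ (deg G w ≤ 6 ∧ deg G y ≤ 6 ∧ deg G z ≤ 6) ∨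
      (deg G w ≤ 6 ∧ deg G x ≤ 6 ∧ deg G z ≤ 6) ∨ (deg G w ≤ 6 ∧ deg G x ≤ 6 ∧ deg G y ≤ 6)) :
    False := by
  classical
  have hT := hG.1
  simp only [List.nodup_cons, List.mem_cons, List.not_mem_nil, or_false, not_or,
    not_false_eq_true, List.nodup_nil, and_true] at hnd
  obtain ⟨⟨n1, n2, n3, n4, n5, n6⟩, ⟨n7, n8, n9, n10, n11⟩, ⟨n12, n13, n14, n15⟩,
    ⟨n16, n17, n18⟩, ⟨n19, n20⟩, n21⟩ := hnd
  obtain ⟨k, K, hKD, hg, hcard⟩ := del_good hG {u, w, x, y, z, u'} (by simp)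
  have hDc : ({u, w, x, y, z, u'} : Finset V).card = 6 := by
    simp [*]
  rw [hDc] at hcard
  have start : ∀ l : List V, (∀ q, q ∈ l ↔ q ∈ ({u, w, x, y, z, u'} : Finset V)) →
      GoodCol G k {q | q ∉ l} K := by
    intro l hl
    simpa only [hl] using hg
  have ku : u ∉ K := fun h => hKD u h (by simp)
  have kw : w ∉ K := fun h => hKD w h (by simp)
  have kx : x ∉ K := fun h => hKD x h (by simp)
  have ky : y ∉ K := fun h => hKD y h (by simp)
  have kz : z ∉ K := fun h => hKD z h (by simp)
  have ku' : u' ∉ K := fun h => hKD u' h (by simp)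
  have fin0 : GoodCol G k {q | q ∉ ([] : List V)} K → False :=
    fun h => not_good_univ hG k K h (by omega)
  have fin1 : ∀ t, GoodCol G k {q | q ∉ ([] : List V)} (insert t K) → False := by
    intro t h
    refine not_good_univ hG k _ h ?_
    have := Set.ncard_insert_le t K
    omega
  have hS1 := And.intro n1 <| And.intro n2 <| And.intro n3 <| And.intro n4 <| And.intro n5 <| And.intro n6 <| And.intro n7 <|
    And.intro n8 <| And.intro n9 <| And.intro n10 <| And.intro n11 <| And.intro n12 <| And.intro n13 <| And.intro n14 <|
    And.intro n15 <| And.intro n16 <| And.intro n17 <| And.intro n18 <| And.intro n19 <| And.intro n20 n21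
  have hS2 := And.intro (Ne.symm n1) <| And.intro (Ne.symm n2) <| And.intro (Ne.symm n3) <| And.intro (Ne.symm n4) <|
    And.intro (Ne.symm n5) <| And.intro (Ne.symm n6) <| And.intro (Ne.symm n7) <| And.intro (Ne.symm n8) <|
    And.intro (Ne.symm n9) <| And.intro (Ne.symm n10) <| And.intro (Ne.symm n11) <| And.intro (Ne.symm n12) <|
    And.intro (Ne.symm n13) <| And.intro (Ne.symm n14) <| And.intro (Ne.symm n15) <| And.intro (Ne.symm n16) <|
    And.intro (Ne.symm n17) <| And.intro (Ne.symm n18) <| And.intro (Ne.symm n19) <| And.intro (Ne.symm n20) (Ne.symm n21)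
  have hS := And.intro hS1 <| And.intro hS2 <| And.intro ku <| And.intro kw <| And.intro kx <|
    And.intro ky <| And.intro kz ku'
  by_cases kv : v ∈ K
  · rcases h7 with ⟨h1, h2, h3⟩ | ⟨h1, h2, h3⟩ | ⟨h1, h2, h3⟩ | ⟨h1, h2, h3⟩
    · have g := start [u', w, x, y, z, u] (by intro q; simp only [Finset.mem_insert, Finset.mem_singleton, List.mem_cons, List.not_mem_nil, or_false]; apply iff_of_eq; ac_rfl)
      replace g := step1 hT v g du' vu'.symm (by simp [hS, kv])
      replace g := step3 hT u v x g hw uw.symm vw.symm wx (by simp [hS, kv])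
      replace g := step2 hT u y g h1 ux.symm xy (by simp [hS, kv])
      replace g := step2 hT u z g h2 uy.symm yz (by simp [hS, kv])
      replace g := step2 hT u v g h3 uz.symm zv (by simp [hS, kv])
      replace g := step1 hT v g du uv (by simp [hS, kv])
      exact fin0 g
    · have g := start [u', x, w, y, z, u] (by intro q; simp only [Finset.mem_insert, Finset.mem_singleton, List.mem_cons, List.not_mem_nil, or_false]; apply iff_of_eq; ac_rfl)
      replace g := step1 hT v g du' vu'.symm (by simp [hS, kv])
      replace g := step3 hT u w y g hx ux.symm wx.symm xy (by simp [hS, kv])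
      replace g := step2 hT u v g h1 uw.symm vw.symm (by simp [hS, kv])
      replace g := step2 hT u z g h2 uy.symm yz (by simp [hS, kv])
      replace g := step2 hT u v g h3 uz.symm zv (by simp [hS, kv])
      replace g := step1 hT v g du uv (by simp [hS, kv])
      exact fin0 g
    · have g := start [u', y, x, w, z, u] (by intro q; simp only [Finset.mem_insert, Finset.mem_singleton, List.mem_cons, List.not_mem_nil, or_false]; apply iff_of_eq; ac_rfl)
      replace g := step1 hT v g du' vu'.symm (by simp [hS, kv])
      replace g := step3 hT u x z g hy uy.symm xy.symm yz (by simp [hS, kv])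
      replace g := step2 hT u w g h2 ux.symm wx.symm (by simp [hS, kv])
      replace g := step2 hT u v g h1 uw.symm vw.symm (by simp [hS, kv])
      replace g := step2 hT u v g h3 uz.symm zv (by simp [hS, kv])
      replace g := step1 hT v g du uv (by simp [hS, kv])
      exact fin0 g
    · have g := start [u', z, y, x, w, u] (by intro q; simp only [Finset.mem_insert, Finset.mem_singleton, List.mem_cons, List.not_mem_nil, or_false]; apply iff_of_eq; ac_rfl)
      replace g := step1 hT v g du' vu'.symm (by simp [hS, kv])
      replace g := step3 hT u v y g hz uz.symm zv yz.symm (by simp [hS, kv])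
      replace g := step2 hT u x g h3 uy.symm xy.symm (by simp [hS, kv])
      replace g := step2 hT u w g h2 ux.symm wx.symm (by simp [hS, kv])
      replace g := step2 hT u v g h1 uw.symm vw.symm (by simp [hS, kv])
      replace g := step1 hT v g du uv (by simp [hS, kv])
      exact fin0 g
  -- now `v` is not in the small class
  have Fw : (∀ p ∈ K, ¬ G.Adj w p) → (deg G x ≤ 6 ∨ (deg G x ≤ 7 ∧ ∃ p ∈ K, G.Adj x p)) →
      (deg G y ≤ 6 ∨ (deg G y ≤ 7 ∧ ∃ p ∈ K, G.Adj y p)) →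
      (deg G z ≤ 6 ∨ (deg G z ≤ 7 ∧ ∃ p ∈ K, G.Adj z p)) → False := by
    intro h0 ex ey ez
    have hsub := Set.subset_insert w K
    have g := step_five (start [w, z, y, x, u, u'] (by intro q; simp only [Finset.mem_insert, Finset.mem_singleton, List.mem_cons, List.not_mem_nil, or_false]; apply iff_of_eq; ac_rfl)) (by simp [hS]) h0
    replace g := stepE hT u y g hsub ez uz.symm yz.symm ku ky (by simp [hS])
    replace g := stepE hT u x g hsub ey uy.symm xy.symm ku kx (by simp [hS])
    replace g := stepE hT u w g hsub ex ux.symm wx.symm ku kw (by simp [hS])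
    replace g := step1 hT w g du uw (by simp [hS])
    replace g := step1 hT w g du' wu'.symm (by simp [hS])
    exact fin1 _ g
  have Fx : (∀ p ∈ K, ¬ G.Adj x p) → (deg G w ≤ 6 ∨ (deg G w ≤ 7 ∧ ∃ p ∈ K, G.Adj w p)) →
      (deg G y ≤ 6 ∨ (deg G y ≤ 7 ∧ ∃ p ∈ K, G.Adj y p)) →
      (deg G z ≤ 6 ∨ (deg G z ≤ 7 ∧ ∃ p ∈ K, G.Adj z p)) → False := by
    intro h0 ew ey ez
    have hsub := Set.subset_insert x K
    have g := step_five (start [x, u', w, z, y, u] (by intro q; simp only [Finset.mem_insert, Finset.mem_singleton, List.mem_cons, List.not_mem_nil, or_false]; apply iff_of_eq; ac_rfl)) (by simp [hS]) h0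
    replace g := step1 hT w g du' wu'.symm (by simp [hS])
    replace g := stepE hT u x g hsub ew uw.symm wx ku kx (by simp [hS])
    replace g := stepE hT u y g hsub ez uz.symm yz.symm ku ky (by simp [hS])
    replace g := stepE hT u x g hsub ey uy.symm xy.symm ku kx (by simp [hS])
    replace g := step1 hT x g du ux (by simp [hS])
    exact fin1 _ g
  have Fy : (∀ p ∈ K, ¬ G.Adj y p) → (deg G w ≤ 6 ∨ (deg G w ≤ 7 ∧ ∃ p ∈ K, G.Adj w p)) →
      (deg G x ≤ 6 ∨ (deg G x ≤ 7 ∧ ∃ p ∈ K, G.Adj x p)) →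
      (deg G z ≤ 6 ∨ (deg G z ≤ 7 ∧ ∃ p ∈ K, G.Adj z p)) → False := by
    intro h0 ew ex ez
    have hsub := Set.subset_insert y K
    have g := step_five (start [y, u', w, x, z, u] (by intro q; simp only [Finset.mem_insert, Finset.mem_singleton, List.mem_cons, List.not_mem_nil, or_false]; apply iff_of_eq; ac_rfl)) (by simp [hS]) h0
    replace g := step1 hT w g du' wu'.symm (by simp [hS])
    replace g := stepE hT u x g hsub ew uw.symm wx ku kx (by simp [hS])
    replace g := stepE hT u y g hsub ex ux.symm xy ku ky (by simp [hS])
    replace g := stepE hT u y g hsub ez uz.symm yz.symm ku ky (by simp [hS])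
    replace g := step1 hT y g du uy (by simp [hS])
    exact fin1 _ g
  have Fz : (∀ p ∈ K, ¬ G.Adj z p) → (deg G w ≤ 6 ∨ (deg G w ≤ 7 ∧ ∃ p ∈ K, G.Adj w p)) →
      (deg G x ≤ 6 ∨ (deg G x ≤ 7 ∧ ∃ p ∈ K, G.Adj x p)) →
      (deg G y ≤ 6 ∨ (deg G y ≤ 7 ∧ ∃ p ∈ K, G.Adj y p)) → False := by
    intro h0 ew ex ey
    have hsub := Set.subset_insert z K
    have g := step_five (start [z, u', w, x, y, u] (by intro q; simp only [Finset.mem_insert, Finset.mem_singleton, List.mem_cons, List.not_mem_nil, or_false]; apply iff_of_eq; ac_rfl)) (by simp [hS]) h0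
    replace g := step1 hT w g du' wu'.symm (by simp [hS])
    replace g := stepE hT u x g hsub ew uw.symm wx ku kx (by simp [hS])
    replace g := stepE hT u y g hsub ex ux.symm xy ku ky (by simp [hS])
    replace g := stepE hT u z g hsub ey uy.symm yz ku kz (by simp [hS])
    replace g := step1 hT z g du uz (by simp [hS])
    exact fin1 _ g
  by_cases pw : ∃ p ∈ K, G.Adj w p
  · by_cases px : ∃ p ∈ K, G.Adj x p
    · by_cases py : ∃ p ∈ K, G.Adj y p
      · by_cases pz : ∃ p ∈ K, G.Adj z p
        · -- all of them see the small class: give `u` the small colour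
          obtain ⟨a, ha, wa⟩ := pw
          obtain ⟨b, hb, xb⟩ := px
          obtain ⟨c, hc, yc⟩ := py
          obtain ⟨d, hd, zd⟩ := pz
          have hfive : ∀ q ∈ K, ¬ G.Adj u q := by
            have hN : ({v, w, x, y, z} : Finset V) = G.neighborFinset u := by
              apply Finset.eq_of_subset_of_card_le
              · intro q hq
                simp only [Finset.mem_insert, Finset.mem_singleton] at hq
                rw [SimpleGraph.mem_neighborFinset]
                rcases hq with rfl | rfl | rfl | rfl | rfl <;> assumption
              · have e5 : ({v, w, x, y, z} : Finset V).card = 5 := by simp [*]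
                rw [e5, SimpleGraph.card_neighborFinset_eq_degree]
                rwa [deg, Nat.card_eq_fintype_card, SimpleGraph.card_neighborSet_eq_degree] at du
            intro q hq hadj
            rw [← SimpleGraph.mem_neighborFinset, ← hN] at hadj
            simp only [Finset.mem_insert, Finset.mem_singleton] at hadj
            rcases hadj with rfl | rfl | rfl | rfl | rfl <;> contradiction
          have e1 : u ≠ a := by rintro rfl; contradiction
          have e2 : u ≠ b := by rintro rfl; contradiction
          have e3 : u ≠ c := by rintro rfl; contradiction
          have e4 : u ≠ d := by rintro rfl; contradiction
          have e5 : a ≠ x := by rintro rfl; contradiction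
          have e6 : b ≠ y := by rintro rfl; contradiction
          have e7 : c ≠ x := by rintro rfl; contradiction
          have e8 : d ≠ y := by rintro rfl; contradiction
          rcases h7 with ⟨h1, h2, h3⟩ | ⟨h1, h2, h3⟩ | ⟨h1, h2, h3⟩ | ⟨h1, h2, h3⟩
          · have g := step_five (start [u, u', w, x, y, z] (by intro q; simp only [Finset.mem_insert, Finset.mem_singleton, List.mem_cons, List.not_mem_nil, or_false]; apply iff_of_eq; ac_rfl)) (by simp [hS]) hfive
            replace g := step1 hT w g du' wu'.symm (by simp [hS, ha, hb, hc, hd, e1, e2, e3, e4, e5, e6, e7, e8])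
            replace g := step3 hT u a x g hw uw.symm wa wx (by simp [hS, ha, hb, hc, hd, e1, e2, e3, e4, e5, e6, e7, e8])
            replace g := step2 hT u b g h1 ux.symm xb (by simp [hS, ha, hb, hc, hd, e1, e2, e3, e4, e5, e6, e7, e8])
            replace g := step2 hT u c g h2 uy.symm yc (by simp [hS, ha, hb, hc, hd, e1, e2, e3, e4, e5, e6, e7, e8])
            replace g := step2 hT u d g h3 uz.symm zd (by simp [hS, ha, hb, hc, hd, e1, e2, e3, e4, e5, e6, e7, e8])
            exact fin1 _ g
          · have g := step_five (start [u, u', x, w, y, z] (by intro q; simp only [Finset.mem_insert, Finset.mem_singleton, List.mem_cons, List.not_mem_nil, or_false]; apply iff_of_eq; ac_rfl)) (by simp [hS]) hfive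
            replace g := step1 hT w g du' wu'.symm (by simp [hS, ha, hb, hc, hd, e1, e2, e3, e4, e5, e6, e7, e8])
            replace g := step3 hT u b y g hx ux.symm xb xy (by simp [hS, ha, hb, hc, hd, e1, e2, e3, e4, e5, e6, e7, e8])
            replace g := step2 hT u a g h1 uw.symm wa (by simp [hS, ha, hb, hc, hd, e1, e2, e3, e4, e5, e6, e7, e8])
            replace g := step2 hT u c g h2 uy.symm yc (by simp [hS, ha, hb, hc, hd, e1, e2, e3, e4, e5, e6, e7, e8])
            replace g := step2 hT u d g h3 uz.symm zd (by simp [hS, ha, hb, hc, hd, e1, e2, e3, e4, e5, e6, e7, e8])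
            exact fin1 _ g
          · have g := step_five (start [u, u', y, w, x, z] (by intro q; simp only [Finset.mem_insert, Finset.mem_singleton, List.mem_cons, List.not_mem_nil, or_false]; apply iff_of_eq; ac_rfl)) (by simp [hS]) hfive
            replace g := step1 hT w g du' wu'.symm (by simp [hS, ha, hb, hc, hd, e1, e2, e3, e4, e5, e6, e7, e8])
            replace g := step3 hT u c x g hy uy.symm yc xy.symm (by simp [hS, ha, hb, hc, hd, e1, e2, e3, e4, e5, e6, e7, e8])
            replace g := step2 hT u a g h1 uw.symm wa (by simp [hS, ha, hb, hc, hd, e1, e2, e3, e4, e5, e6, e7, e8])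
            replace g := step2 hT u b g h2 ux.symm xb (by simp [hS, ha, hb, hc, hd, e1, e2, e3, e4, e5, e6, e7, e8])
            replace g := step2 hT u d g h3 uz.symm zd (by simp [hS, ha, hb, hc, hd, e1, e2, e3, e4, e5, e6, e7, e8])
            exact fin1 _ g
          · have g := step_five (start [u, u', z, w, x, y] (by intro q; simp only [Finset.mem_insert, Finset.mem_singleton, List.mem_cons, List.not_mem_nil, or_false]; apply iff_of_eq; ac_rfl)) (by simp [hS]) hfive
            replace g := step1 hT w g du' wu'.symm (by simp [hS, ha, hb, hc, hd, e1, e2, e3, e4, e5, e6, e7, e8])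
            replace g := step3 hT u d y g hz uz.symm zd yz.symm (by simp [hS, ha, hb, hc, hd, e1, e2, e3, e4, e5, e6, e7, e8])
            replace g := step2 hT u a g h1 uw.symm wa (by simp [hS, ha, hb, hc, hd, e1, e2, e3, e4, e5, e6, e7, e8])
            replace g := step2 hT u b g h2 ux.symm xb (by simp [hS, ha, hb, hc, hd, e1, e2, e3, e4, e5, e6, e7, e8])
            replace g := step2 hT u c g h3 uy.symm yc (by simp [hS, ha, hb, hc, hd, e1, e2, e3, e4, e5, e6, e7, e8])
            exact fin1 _ g
        · exact Fz (by simpa using pz) (Or.inr ⟨hw, pw⟩) (Or.inr ⟨hx, px⟩) (Or.inr ⟨hy, py⟩)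
      · have qy : ∀ p ∈ K, ¬ G.Adj y p := by simpa using py
        by_cases pz : ∃ p ∈ K, G.Adj z p
        · exact Fy qy (Or.inr ⟨hw, pw⟩) (Or.inr ⟨hx, px⟩) (Or.inr ⟨hz, pz⟩)
        · by_cases hz6 : deg G z ≤ 6
          · exact Fy qy (Or.inr ⟨hw, pw⟩) (Or.inr ⟨hx, px⟩) (Or.inl hz6)
          · exact Fz (by simpa using pz) (Or.inr ⟨hw, pw⟩) (Or.inr ⟨hx, px⟩) (Or.inl (by omega))
    · have qx : ∀ p ∈ K, ¬ G.Adj x p := by simpa using px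
      by_cases py : ∃ p ∈ K, G.Adj y p
      · by_cases hz6 : deg G z ≤ 6
        · exact Fx qx (Or.inr ⟨hw, pw⟩) (Or.inr ⟨hy, py⟩) (Or.inl hz6)
        · by_cases pz : ∃ p ∈ K, G.Adj z p
          · exact Fx qx (Or.inr ⟨hw, pw⟩) (Or.inr ⟨hy, py⟩) (Or.inr ⟨hz, pz⟩)
          · exact Fz (by simpa using pz) (Or.inl (by omega)) (Or.inl (by omega)) (Or.inl (by omega))
      · by_cases hy6 : deg G y ≤ 6
        · by_cases hz6 : deg G z ≤ 6
          · exact Fx qx (Or.inr ⟨hw, pw⟩) (Or.inl hy6) (Or.inl hz6)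
          · by_cases pz : ∃ p ∈ K, G.Adj z p
            · exact Fx qx (Or.inr ⟨hw, pw⟩) (Or.inl hy6) (Or.inr ⟨hz, pz⟩)
            · exact Fz (by simpa using pz) (Or.inl (by omega)) (Or.inl (by omega))
                (Or.inl (by omega))
        · exact Fy (by simpa using py) (Or.inl (by omega)) (Or.inl (by omega)) (Or.inl (by omega))
  · have qw : ∀ p ∈ K, ¬ G.Adj w p := by simpa using pw
    by_cases hx6 : deg G x ≤ 6
    · by_cases hy6 : deg G y ≤ 6
      · by_cases hz6 : deg G z ≤ 6
        · exact Fw qw (Or.inl hx6) (Or.inl hy6) (Or.inl hz6)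
        · by_cases pz : ∃ p ∈ K, G.Adj z p
          · exact Fw qw (Or.inl hx6) (Or.inl hy6) (Or.inr ⟨hz, pz⟩)
          · exact Fz (by simpa using pz) (Or.inl (by omega)) (Or.inl (by omega)) (Or.inl (by omega))
      · by_cases py : ∃ p ∈ K, G.Adj y p
        · exact Fw qw (Or.inl hx6) (Or.inr ⟨hy, py⟩) (Or.inl (by omega))
        · exact Fy (by simpa using py) (Or.inl (by omega)) (Or.inl (by omega)) (Or.inl (by omega))
    · by_cases px : ∃ p ∈ K, G.Adj x p
      · exact Fw qw (Or.inr ⟨hx, px⟩) (Or.inl (by omega)) (Or.inl (by omega))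
      · exact Fx (by simpa using px) (Or.inl (by omega)) (Or.inl (by omega)) (Or.inl (by omega))

end Steps

theorem face_iter [Fintype V] {G : SimpleGraph V} {σ : Equiv.Perm G.Dart}
    (hT : IsPlaneTriangulation G σ) (d : G.Dart) :
    facePerm σ (facePerm σ (facePerm σ d)) = d := by
  classical
  have h3 := hT.face_size_eq d
  set f := facePerm σ with hf
  have hp : Function.minimalPeriod (f • ·) d = 3 := by
    have : Finite (MulAction.orbit (Subgroup.zpowers f) d) := inferInstance
    have := Fintype.ofFinite (MulAction.orbit (Subgroup.zpowers f) d)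
    rw [MulAction.minimalPeriod_eq_card, ← Nat.card_eq_fintype_card, ← h3, faceSize]
    apply Nat.card_congr
    refine Equiv.subtypeEquivRight fun e => ?_
    constructor
    · rintro ⟨⟨_, i, rfl⟩, rfl⟩
      exact ⟨i, rfl⟩
    · rintro ⟨i, rfl⟩
      exact ⟨⟨_, i, rfl⟩, rfl⟩
  have := Function.iterate_minimalPeriod (f := (f • ·)) (x := d)
  rw [hp] at this
  exact this

theorem next_dart {G : SimpleGraph V} {σ : Equiv.Perm G.Dart}
    (hR : IsRotationSystem G σ) {q p r : V} :
    NextNbr σ q p r ↔ ∃ (h : G.Adj q p) (h' : G.Adj q r), σ ⟨(q, p), h⟩ = ⟨(q, r), h'⟩ := by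
  constructor
  · rintro ⟨h, rfl⟩
    have h1 := hR.fst_eq ⟨(q, p), h⟩
    have h2 := (σ ⟨(q, p), h⟩).adj
    refine ⟨h, ?_, ?_⟩
    · simpa only [h1] using h2
    · apply SimpleGraph.Dart.ext
      exact Prod.ext h1 rfl
  · rintro ⟨h, h', e⟩
    exact ⟨h, by rw [e]⟩

/-- The abstract properties of the relation `r` follows `p` around `q` used below. -/
structure RotRel (G : SimpleGraph V) (N : V → V → V → Prop) : Prop where
  adjL : ∀ {q p r}, N q p r → G.Adj q p
  adjR : ∀ {q p r}, N q p r → G.Adj q r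
  tot : ∀ {q p}, G.Adj q p → ∃ r, N q p r
  totL : ∀ {q r}, G.Adj q r → ∃ p, N q p r
  fn : ∀ {q p r s}, N q p r → N q p s → r = s
  inj : ∀ {q p r s}, N q p r → N q s r → p = s
  cyc : ∀ {q p r}, N q p r → N r q p
  closed : ∀ {q} (A : Set V), (∀ p r, p ∈ A → N q p r → r ∈ A) →
    ∀ a b, a ∈ A → G.Adj q a → G.Adj q b → b ∈ A

theorem RotRel.mirror {G : SimpleGraph V} {N : V → V → V → Prop} (h : RotRel G N) :
    RotRel G (fun q p r => N q r p) where
  adjL := fun e => h.adjR e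
  adjR := fun e => h.adjL e
  tot := fun e => h.totL e
  totL := fun e => h.tot e
  fn := fun e e' => h.inj e e'
  inj := fun e e' => h.fn e e'
  cyc := fun e => h.cyc (h.cyc e)
  closed := by
    intro q A hA a b ha qa qb
    by_contra hb
    exact h.closed Aᶜ (fun p r hp hN hr => hp (hA r p hr hN)) b a hb qb qa ha

theorem rotRel_next [Fintype V] {G : SimpleGraph V} {σ : Equiv.Perm G.Dart}
    (hT : IsPlaneTriangulation G σ) : RotRel G (NextNbr σ) where
  adjL := fun e => e.1
  adjR := fun e => ((next_dart hT.rot).1 e).2.1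
  tot := fun e => ⟨_, e, rfl⟩
  totL := by
    intro q r e
    have h1 := hT.rot.fst_eq (σ.symm ⟨(q, r), e⟩)
    rw [Equiv.apply_symm_apply] at h1
    refine ⟨(σ.symm ⟨(q, r), e⟩).snd, ?_, ?_⟩
    · have h2 := (σ.symm ⟨(q, r), e⟩).adj
      rw [← h1] at h2; exact h2
    · have : σ.symm ⟨(q, r), e⟩ = ⟨(q, (σ.symm ⟨(q, r), e⟩).snd), by
        have h2 := (σ.symm ⟨(q, r), e⟩).adj
        rw [← h1] at h2; exact h2⟩ := by
        apply SimpleGraph.Dart.ext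
        exact Prod.ext h1.symm rfl
      rw [← this, Equiv.apply_symm_apply]
  fn := by
    rintro q p r s ⟨h, rfl⟩ ⟨_, rfl⟩; rfl
  inj := by
    intro q p r s h1 h2
    obtain ⟨a, b, e⟩ := (next_dart hT.rot).1 h1
    obtain ⟨a', b', e'⟩ := (next_dart hT.rot).1 h2
    have := σ.injective (e.trans e'.symm)
    simpa using this
  cyc := by
    intro q p r h1
    obtain ⟨a, b, e⟩ := (next_dart hT.rot).1 h1
    obtain ⟨s, h2⟩ : ∃ s, NextNbr σ r q s := ⟨_, b.symm, rfl⟩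
    obtain ⟨a', b', e'⟩ := (next_dart hT.rot).1 h2
    have h3 := face_iter hT ⟨(p, q), a.symm⟩
    have f1 : facePerm σ ⟨(p, q), a.symm⟩ = ⟨(q, r), b⟩ := e
    have f2 : facePerm σ ⟨(q, r), b⟩ = ⟨(r, s), b'⟩ := e'
    rw [f1, f2] at h3
    have h4 := hT.rot.fst_eq ⟨(s, r), b'.symm⟩
    have f3 : facePerm σ ⟨(r, s), b'⟩ = σ ⟨(s, r), b'.symm⟩ := rfl
    rw [f3] at h3
    rw [h3] at h4
    have h5 : p = s := h4
    rw [h5]; exact h2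
  closed := by
    intro q A hA a b ha qa qb
    have : Finite G.Dart := by classical infer_instance
    obtain ⟨i, hi⟩ := (hT.rot.orbit_eq ⟨(q, a), qa⟩ ⟨(q, b), qb⟩ rfl).exists_nat_pow_eq
    have key : ∀ i : ℕ, ((σ ^ i) ⟨(q, a), qa⟩).fst = q ∧ ((σ ^ i) ⟨(q, a), qa⟩).snd ∈ A := by
      intro i
      induction i with
      | zero => exact ⟨rfl, ha⟩
      | succ n ih =>
        rw [pow_succ', Equiv.Perm.mul_apply]
        generalize (σ ^ n) ⟨(q, a), qa⟩ = d at ih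
        obtain ⟨⟨d1, d2⟩, hd⟩ := d
        obtain ⟨rfl, h2⟩ := ih
        exact ⟨hT.rot.fst_eq _, hA d2 _ h2 ⟨hd, rfl⟩⟩
    have := (key i).2
    rwa [hi] at this

theorem deg_le_of_closed [Finite V] {G : SimpleGraph V} {N : V → V → V → Prop} (h : RotRel G N)
    (q : V) (A : Finset V) (hA : ∀ p r, p ∈ A → N q p r → r ∈ A) (a : V) (ha : a ∈ A)
    (qa : G.Adj q a) : deg G q ≤ A.card := by
  have hs : G.neighborSet q ⊆ (A : Set V) := fun b hb =>
    h.closed (A : Set V) hA a b ha qa hb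
  have := Set.ncard_le_ncard hs (A.finite_toSet)
  rw [Set.ncard_coe_finset] at this
  exact this

theorem deg_le_three [Finite V] {G : SimpleGraph V} {N : V → V → V → Prop} (h : RotRel G N)
    {q a b c : V} (hab : N q a b) (hbc : N q b c) (hca : N q c a) : deg G q ≤ 3 := by
  classical
  refine (deg_le_of_closed h q {a, b, c} ?_ a (by simp) (h.adjL hab)).trans Finset.card_le_three
  intro p r hp hr
  simp only [Finset.mem_insert, Finset.mem_singleton] at hp ⊢
  rcases hp with rfl | rfl | rfl
  · exact Or.inr (Or.inl (h.fn hr hab))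
  · exact Or.inr (Or.inr (h.fn hr hbc))
  · exact Or.inl (h.fn hr hca)

theorem deg_le_four [Finite V] {G : SimpleGraph V} {N : V → V → V → Prop} (h : RotRel G N)
    {q a b c d : V} (hab : N q a b) (hbc : N q b c) (hcd : N q c d) (hda : N q d a) :
    deg G q ≤ 4 := by
  classical
  refine (deg_le_of_closed h q {a, b, c, d} ?_ a (by simp) (h.adjL hab)).trans Finset.card_le_four
  intro p r hp hr
  simp only [Finset.mem_insert, Finset.mem_singleton] at hp ⊢
  rcases hp with rfl | rfl | rfl | rfl
  · exact Or.inr (Or.inl (h.fn hr hab))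
  · exact Or.inr (Or.inr (Or.inl (h.fn hr hbc)))
  · exact Or.inr (Or.inr (Or.inr (h.fn hr hcd)))
  · exact Or.inl (h.fn hr hda)

theorem wheel_five [Finite V] {G : SimpleGraph V} {N : V → V → V → Prop} (h : RotRel G N)
    {u v w : V} (hd : deg G u = 5) (hwv : N u w v) :
    ∃ x y z, N u v z ∧ N u z y ∧ N u y x ∧ N u x w ∧ [w, v, z, y, x].Nodup ∧
      ∀ q, G.Adj u q → q = w ∨ q = v ∨ q = z ∨ q = y ∨ q = x := by
  classical
  obtain ⟨z, hvz⟩ := h.tot (h.adjR hwv)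
  obtain ⟨y, hzy⟩ := h.tot (h.adjR hvz)
  obtain ⟨x, hyx⟩ := h.tot (h.adjR hzy)
  obtain ⟨t, hxt⟩ := h.tot (h.adjR hyx)
  have a1 : w ≠ v := by
    rintro rfl; have := deg_le_three h hwv hwv hwv; omega
  have a2 : w ≠ z := by
    rintro rfl; have := deg_le_four h hwv hvz hwv hvz; omega
  have a3 : w ≠ y := by
    rintro rfl; have := deg_le_three h hwv hvz hzy; omega
  have a4 : w ≠ x := by
    rintro rfl; have := deg_le_four h hwv hvz hzy hyx; omega
  have b1 : v ≠ z := by rintro rfl; exact a1 (h.inj hwv hvz)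
  have b2 : v ≠ y := by rintro rfl; exact a2 (h.inj hwv hzy)
  have b3 : v ≠ x := by rintro rfl; exact a3 (h.inj hwv hyx)
  have c1 : z ≠ y := by rintro rfl; exact b1 (h.inj hvz hzy)
  have c2 : z ≠ x := by rintro rfl; exact b2 (h.inj hvz hyx)
  have d1 : y ≠ x := by rintro rfl; exact c1 (h.inj hzy hyx)
  have hN : (({w, v, z, y, x} : Finset V) : Set V) = G.neighborSet u := by
    apply Set.eq_of_subset_of_ncard_le
    · intro q hq
      simp only [Finset.coe_insert, Finset.coe_singleton, Set.mem_insert_iff,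
        Set.mem_singleton_iff] at hq
      rcases hq with rfl | rfl | rfl | rfl | rfl
      · exact h.adjL hwv
      · exact h.adjR hwv
      · exact h.adjR hvz
      · exact h.adjR hzy
      · exact h.adjR hyx
    · rw [Set.ncard_coe_finset]
      have e5 : ({w, v, z, y, x} : Finset V).card = 5 := by simp [*]
      rw [e5]; exact hd.le
    · exact Set.toFinite _
  have hall : ∀ q, G.Adj u q → q = w ∨ q = v ∨ q = z ∨ q = y ∨ q = x := by
    intro q hq
    have : q ∈ G.neighborSet u := hq
    rw [← hN] at this
    simpa using this
  refine ⟨x, y, z, hvz, hzy, hyx, ?_, by simp [*], hall⟩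
  rcases hall t (h.adjR hxt) with rfl | rfl | rfl | rfl | rfl
  · exact hxt
  · exact absurd (h.inj hwv hxt) a4
  · exact absurd (h.inj hvz hxt) b3
  · exact absurd (h.inj hzy hxt) c2
  · exact absurd (h.inj hyx hxt) d1

theorem main_abs [Fintype V] {G : SimpleGraph V} {σ : Equiv.Perm G.Dart}
    (hG : IsMinimalCounterexample G σ) {N : V → V → V → Prop} (h : RotRel G N) (v u u' w : V)
    (hv : 9 ≤ deg G v) (hd : deg G u = 5) (hd' : deg G u' = 5) (hne : u ≠ u')
    (h1 : N v u w) (h2 : N v w u') :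
    (∃ w : V, w ≠ v ∧ G.Adj u w ∧ 8 ≤ deg G w) ∨
    2 ≤ Nat.card {w : V | w ≠ v ∧ G.Adj u w ∧ 7 ≤ deg G w} := by
  classical
  by_contra hcon
  push Not at hcon
  obtain ⟨c1, c2⟩ := hcon
  have md := min_deg hG
  have uwv : N u w v := h.cyc (h.cyc h1)
  obtain ⟨x, y, z, uvz, uzy, uyx, uxw, hnd, hall⟩ := wheel_five h hd uwv
  simp only [List.nodup_cons, List.mem_cons, List.not_mem_nil, or_false, not_or,
    not_false_eq_true, List.nodup_nil, and_true] at hnd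
  obtain ⟨⟨nwv, nwz, nwy, nwx⟩, ⟨nvz, nvy, nvx⟩, ⟨nzy, nzx⟩, nyx⟩ := hnd
  have uv := h.adjR uwv
  have uw := h.adjL uwv
  have uz := h.adjR uvz
  have uy := h.adjR uzy
  have ux := h.adjR uyx
  have vw := h.adjR h1
  have wx : G.Adj w x := h.adjR (h.cyc uxw)
  have xy : G.Adj x y := h.adjR (h.cyc uyx)
  have yz : G.Adj y z := h.adjR (h.cyc uzy)
  have zv : G.Adj z v := h.adjR (h.cyc uvz)
  have vu' := h.adjR h2
  have wu' : G.Adj w u' := (h.adjR (h.cyc h2)).symm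
  have nu'z : z ≠ u' := by
    rintro rfl
    have := deg_le_three h h1 h2 (h.cyc (h.cyc uvz))
    omega
  have nu'x : x ≠ u' := by
    rintro rfl
    have e1 : N w x v := h.cyc (h.cyc h2)
    have e2 : N w v u := h.cyc h1
    have e3 : N w u x := h.cyc uxw
    have := deg_le_three h e1 e2 e3
    have := md w
    omega
  have nu'y : y ≠ u' := by
    rintro rfl
    -- around `y`: `x → u → z` and `v → w`
    have e1 : N y x u := h.cyc (h.cyc uyx)
    have e2 : N y u z := h.cyc uzy
    have e3 : N y v w := h.cyc h2
    obtain ⟨p, q, r, yur, yrq, yqp, ypx, _, hall'⟩ := wheel_five h hd' e1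
    obtain rfl : z = r := h.fn e2 yur
    have yv : G.Adj y v := h.adjL e3
    rcases hall' v yv with h3 | h3 | h3 | h3 | h3
    · exact nvx h3
    · exact uv.ne' h3
    · exact nvz h3
    · subst h3
      obtain rfl : w = p := h.fn e3 yqp
      have := deg_le_three h (h.cyc ypx) (h.cyc (h.cyc uxw)) (h.cyc uyx)
      have := md x
      omega
    · subst h3
      exact nwx (h.fn e3 ypx)
  refine core hG v u w x y z u' ?_ uv uw ux uy uz vw wx xy yz zv vu' wu' hd.le hd'.le ?_ ?_ ?_ ?_ ?_
  · simp only [List.nodup_cons, List.mem_cons, List.not_mem_nil, or_false, not_or,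
      not_false_eq_true, List.nodup_nil, and_true]
    exact ⟨⟨uv.ne', (Ne.symm nwv), nvx, nvy, nvz, vu'.ne⟩, ⟨uw.ne, ux.ne, uy.ne, uz.ne, hne⟩,
      ⟨nwx, nwy, nwz, wu'.ne⟩, ⟨(Ne.symm nyx), (Ne.symm nzx), nu'x⟩, ⟨(Ne.symm nzy), nu'y⟩, nu'z⟩
  · have := c1 w nwv uw; omega
  · have := c1 x (Ne.symm nvx) ux; omega
  · have := c1 y (Ne.symm nvy) uy; omega
  · have := c1 z (Ne.symm nvz) uz; omega
  · have two : ∀ a b, a ≠ b → a ≠ v → b ≠ v → G.Adj u a → G.Adj u b →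
        deg G a ≤ 6 ∨ deg G b ≤ 6 := by
      intro a b hab av bv ua ub
      by_contra hdd
      have da : 7 ≤ deg G a := by omega
      have db : 7 ≤ deg G b := by omega
      have hs : (({a, b} : Finset V) : Set V) ⊆ {w : V | w ≠ v ∧ G.Adj u w ∧ 7 ≤ deg G w} := by
        intro q hq
        simp only [Finset.coe_insert, Finset.coe_singleton, Set.mem_insert_iff,
          Set.mem_singleton_iff] at hq
        rcases hq with rfl | rfl
        · exact ⟨av, ua, da⟩
        · exact ⟨bv, ub, db⟩
      have h3 := Set.ncard_le_ncard hs (Set.toFinite _)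
      rw [Set.ncard_coe_finset, Finset.card_pair hab] at h3
      have h4 : Set.ncard {w : V | w ≠ v ∧ G.Adj u w ∧ 7 ≤ deg G w} < 2 := c2
      omega
    have twx := two w x nwx nwv (Ne.symm nvx) uw ux
    have twy := two w y nwy nwv (Ne.symm nvy) uw uy
    have twz := two w z nwz nwv (Ne.symm nvz) uw uz
    have txy := two x y (Ne.symm nyx) (Ne.symm nvx) (Ne.symm nvy) ux uy
    have txz := two x z (Ne.symm nzx) (Ne.symm nvx) (Ne.symm nvz) ux uz
    have tyz := two y z (Ne.symm nzy) (Ne.symm nvy) (Ne.symm nvz) uy uz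
    omega

theorem statement14 [Fintype V] (G : SimpleGraph V) (σ : Equiv.Perm G.Dart)
    (hG : IsMinimalCounterexample G σ) (v u u' : V)
    (hv : 9 ≤ deg G v) (hu : G.Adj v u) (hu' : G.Adj v u')
    (hd : deg G u = 5) (hd' : deg G u' = 5) (hne : u ≠ u')
    (hdist2 : ∃ w : V, (NextNbr σ v u w ∧ NextNbr σ v w u') ∨
      (NextNbr σ v u' w ∧ NextNbr σ v w u)) :
    (∃ w : V, w ≠ v ∧ G.Adj u w ∧ 8 ≤ deg G w) ∨
    2 ≤ Nat.card {w : V | w ≠ v ∧ G.Adj u w ∧ 7 ≤ deg G w} := by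
  obtain ⟨w, ⟨h1, h2⟩ | ⟨h1, h2⟩⟩ := hdist2
  · exact main_abs hG (rotRel_next hG.1) v u u' w hv hd hd' hne h1 h2
  · exact main_abs hG (rotRel_next hG.1).mirror v u u' w hv hd hd' hne h2 h1
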